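/- Suppose p ∈ ℕ, p ≥ 1, and γ > 4d(κp + ρ). Then λ_p := sup σ(H^p) is positive, λ_p is isolated in the spectrum of H^p (there is ε > 0 with σ(H^p) ∩ (λ_p − ε, λ_p + ε) = {λ_p}), λ_p is an eigenvalue of H^p with one-dimensional eigenspace, and this eigenspace is spanned by a strictly positive function. -/

import Mathlib

open Filter Topology

/-- The real Hilbert space of square-summable functions on `X`. -/
abbrev RealL2 (X : Type*) := lp (fun _ : X => ℝ) 2

lemma RealL2.sub_apply {X : Type*} (f g : RealL2 X) (x : X) : (f - g) x = f x - g x := rfl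

lemma RealL2.smul_apply {X : Type*} (c : ℝ) (f : RealL2 X) (x : X) : (c • f) x = c * f x := rfl

lemma RealL2.algebraMap_sub_apply {X : Type*} (z : ℝ) (D : RealL2 X →L[ℝ] RealL2 X)
    (f : RealL2 X) :
    (algebraMap ℝ (RealL2 X →L[ℝ] RealL2 X) z - D) f = z • f - D f := rfl

lemma RealL2.hasSum_sq {X : Type*} (f : RealL2 X) : HasSum (fun x => f x ^ 2) (‖f‖ ^ 2) := by
  have h := lp.hasSum_inner (𝕜 := ℝ) f f
  rw [real_inner_self_eq_norm_sq] at h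
  refine h.congr_fun fun x => ?_
  simp

lemma RealL2.exists_forall_ge_of_neg {X : Type*} (f : RealL2 X) {x₀ : X} (h₀ : f x₀ < 0) :
    ∃ x, f x < 0 ∧ ∀ y, f x ≤ f y := by
  have ht : Tendsto (fun x => f x ^ 2) cofinite (𝓝 0) :=
    (RealL2.hasSum_sq f).summable.tendsto_cofinite_zero
  have hfin : {x | f x ≤ f x₀}.Finite := by
    have hev := ht.eventually (gt_mem_nhds (sq_pos_of_neg h₀))
    refine (Filter.eventually_cofinite.1 hev).subset fun x hx => ?_
    have hx' : f x ≤ f x₀ := hx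
    simp only [Set.mem_ofPred_eq, not_lt]
    nlinarith
  obtain ⟨x, hx, hmin⟩ := Set.exists_min_image _ (fun x => f x) hfin ⟨x₀, le_refl (f x₀)⟩
  have hx' : f x ≤ f x₀ := hx
  refine ⟨x, hx'.trans_lt h₀, fun y => ?_⟩
  rcases le_total (f y) (f x₀) with hy | hy
  · exact hmin y hy
  · exact hx'.trans hy

/-- `D` is a weighted nearest-neighbour Laplacian with steps `e` and weights `w` plus
multiplication by the potential `U`. -/
def IsSchrodinger {X J : Type*} [AddCommGroup X] [Fintype J] (e : J → X) (w : J → ℝ) (U : X → ℝ)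
    (D : RealL2 X →L[ℝ] RealL2 X) : Prop :=
  ∀ (f : RealL2 X) (x : X), D f x = ∑ j, w j * (f (x + e j) - f x) + U x * f x

section Schrodinger

variable {X J : Type*} [AddCommGroup X] [Fintype J] {e : J → X} {w : J → ℝ} {U : X → ℝ}
  {D : RealL2 X →L[ℝ] RealL2 X} {M z : ℝ}

lemma IsSchrodinger.inner_le (hD : IsSchrodinger e w U D) (hw : ∀ j, 0 < w j) (hU : ∀ x, U x ≤ M)
    (f : RealL2 X) : inner ℝ (D f) f ≤ M * ‖f‖ ^ 2 := by
  have h1 := lp.hasSum_inner (𝕜 := ℝ) (D f) f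
  have hsq := RealL2.hasSum_sq f
  have hshift : ∀ j, HasSum (fun x => f (x + e j) ^ 2) (‖f‖ ^ 2) := fun j =>
    (Equiv.addRight (e j)).hasSum_iff (f := fun x => f x ^ 2) |>.2 hsq
  have h2 : HasSum (fun x => ∑ j, w j * ((f (x + e j) ^ 2 - f x ^ 2) / 2) + M * f x ^ 2)
      (∑ j, w j * ((‖f‖ ^ 2 - ‖f‖ ^ 2) / 2) + M * ‖f‖ ^ 2) :=
    HasSum.add (hasSum_sum fun j _ => (((hshift j).sub hsq).div_const 2).mul_left (w j))
      (hsq.mul_left M)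
  simp only [sub_self, zero_div, mul_zero, Finset.sum_const_zero, zero_add] at h2
  refine hasSum_le (fun x => ?_) h1 h2
  have h3 : inner ℝ (D f x) (f x) = D f x * f x := by
    simp [mul_comm]
  rw [h3, hD f x, add_mul, Finset.sum_mul]
  refine add_le_add (Finset.sum_le_sum fun j _ => ?_) ?_
  · nlinarith [mul_nonneg (hw j).le (sq_nonneg (f (x + e j) - f x))]
  · nlinarith [mul_nonneg (sub_nonneg.2 (hU x)) (sq_nonneg (f x))]

lemma IsSchrodinger.le_inner (hD : IsSchrodinger e w U D) (hw : ∀ j, 0 < w j) (hU : ∀ x, U x ≤ M)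
    (f : RealL2 X) : (z - M) * ‖f‖ ^ 2 ≤ inner ℝ (z • f - D f) f := by
  rw [inner_sub_left, real_inner_smul_left, real_inner_self_eq_norm_sq]
  linarith [hD.inner_le hw hU f]

lemma IsSchrodinger.isUnit_sub (hD : IsSchrodinger e w U D) (hw : ∀ j, 0 < w j)
    (hU : ∀ x, U x ≤ M) (hz : M < z) : IsUnit (algebraMap ℝ _ z - D) := by
  have hco : IsCoercive ((innerSL ℝ).comp (algebraMap ℝ (RealL2 X →L[ℝ] RealL2 X) z - D)) := by
    refine ⟨z - M, sub_pos.2 hz, fun f => ?_⟩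
    have := hD.le_inner (z := z) hw hU f
    rwa [sq, ← mul_assoc] at this
  have heq : ∀ f, hco.continuousLinearEquivOfBilin f
      = (algebraMap ℝ (RealL2 X →L[ℝ] RealL2 X) z - D) f := fun f =>
    ext_inner_right ℝ fun g => by
      rw [hco.continuousLinearEquivOfBilin_apply]; rfl
  rw [ContinuousLinearMap.isUnit_iff_bijective]
  have := hco.continuousLinearEquivOfBilin.bijective
  rwa [show ⇑hco.continuousLinearEquivOfBilin = _ from funext heq] at this

/-- The strong minimum principle. -/
lemma IsSchrodinger.pos_of_resolvent_nonneg (hD : IsSchrodinger e w U D) (hw : ∀ j, 0 < w j)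
    (hU : ∀ x, U x ≤ M) (hz : M < z) (he : AddSubmonoid.closure (Set.range e) = ⊤)
    {f g : RealL2 X} (hfg : z • f - D f = g) (hg : ∀ x, 0 ≤ g x) (hg0 : ∃ x, 0 < g x) (x : X) :
    0 < f x := by
  have hpt : ∀ x, (z - U x) * f x = g x + ∑ j, w j * (f (x + e j) - f x) := fun x => by
    have h : z * f x - D f x = g x := by
      rw [← hfg, RealL2.sub_apply, RealL2.smul_apply]
    rw [hD f x] at h
    linarith
  have hnonneg : ∀ x, 0 ≤ f x := by
    by_contra! hneg
    obtain ⟨x₀, hx₀⟩ := hneg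
    obtain ⟨x, hx, hmin⟩ := RealL2.exists_forall_ge_of_neg f hx₀
    have h1 : 0 ≤ ∑ j, w j * (f (x + e j) - f x) :=
      Finset.sum_nonneg fun j _ => mul_nonneg (hw j).le (sub_nonneg.2 (hmin _))
    nlinarith [hpt x, hg x, hU x]
  by_contra hx
  have hx0 : f x = 0 := le_antisymm (not_lt.1 hx) (hnonneg x)
  have hstep : ∀ y, f y = 0 → g y = 0 ∧ ∀ j, f (y + e j) = 0 := fun y hy => by
    have h := hpt y
    simp only [hy, mul_zero, sub_zero] at h
    have hs : ∀ j ∈ Finset.univ, 0 ≤ w j * f (y + e j) := fun j _ =>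
      mul_nonneg (hw j).le (hnonneg _)
    have h1 := Finset.sum_nonneg hs
    have h2 := hg y
    refine ⟨by linarith, fun j => ?_⟩
    have h3 := (Finset.sum_eq_zero_iff_of_nonneg hs).1 (by linarith) j (Finset.mem_univ j)
    exact (mul_eq_zero.1 h3).resolve_left (hw j).ne'
  have hall : ∀ y ∈ AddSubmonoid.closure (Set.range e), f (x + y) = 0 := fun y hy => by
    induction hy using AddSubmonoid.closure_induction_right with
    | zero => simpa using hx0
    | add_right y _ s hs ih =>
      obtain ⟨j, rfl⟩ := hs
      rw [← add_assoc]
      exact (hstep _ ih).2 j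
  obtain ⟨y, hy⟩ := hg0
  have := hall (y - x) (he ▸ AddSubmonoid.mem_top _)
  rw [add_sub_cancel] at this
  exact hy.ne' (hstep y this).1

end Schrodinger

/-- A Schrödinger operator whose potential has a sufficiently high peak at a single site has an
isolated, simple top of the spectrum with a strictly positive eigenfunction. -/
theorem IsSchrodinger.exists_principal_eigenfunction {X J : Type*} [AddCommGroup X]
    [DecidableEq X] [Fintype J] {e : J → X} {w : J → ℝ} {V : X → ℝ} {M : ℝ} {o : X}
    {H : RealL2 X →L[ℝ] RealL2 X} (hH : IsSchrodinger e w V H) (hw : ∀ j, 0 < w j)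
    (he : AddSubmonoid.closure (Set.range e) = ⊤) (hV : ∀ x ≠ o, V x ≤ M)
    (hVo : M + ∑ j, w j < V o) :
    ∃ μ, V o - ∑ j, w j ≤ μ ∧ μ ∈ spectrum ℝ H ∧ (∀ z ∈ spectrum ℝ H, M < z → z = μ) ∧
      ∃ v : RealL2 X, (∀ x, 0 < v x) ∧ H v = μ • v ∧
        ∀ f : RealL2 X, H f = μ • f → ∃ c : ℝ, f = c • v := by
  set W := ∑ j, w j with hW
  have hW0 : 0 ≤ W := Finset.sum_nonneg fun j _ => (hw j).le
  set g := V o - M with hg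
  have hg0 : 0 < g := by linarith
  let δ : RealL2 X := lp.single 2 o 1
  have hδ : ∀ x, δ x = if x = o then 1 else 0 := fun x => by
    simp [δ, lp.single_apply, Pi.single_apply]
  have hδo : δ o = 1 := by simp [hδ]
  let P : RealL2 X →L[ℝ] RealL2 X := (lp.evalCLM ℝ (fun _ : X => ℝ) 2 o).smulRight δ
  have hP : ∀ f, P f = f o • δ := fun f => rfl
  let D := H - g • P
  have hDH : ∀ f, D f = H f - (g * f o) • δ := fun f => by
    simp [D, hP, smul_smul]
  have hD : IsSchrodinger e w (fun x => if x = o then M else V x) D := fun f x => by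
    have : D f x = H f x - g * f o * δ x := by
      rw [hDH, RealL2.sub_apply, RealL2.smul_apply]
    rw [this, hH f x, hδ]
    by_cases hx : x = o
    · subst hx; simp only [if_true]; ring
    · simp [hx]
  have hU : ∀ x, (if x = o then M else V x) ≤ M := fun x => by
    split_ifs with hx
    exacts [le_rfl, hV x hx]
  have hunit : ∀ z, M < z → IsUnit (algebraMap ℝ (RealL2 X →L[ℝ] RealL2 X) z - D) := fun z hz =>
    hD.isUnit_sub hw hU hz
  let R : ℝ → RealL2 X →L[ℝ] RealL2 X := fun z => Ring.inverse (algebraMap ℝ _ z - D)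
  have hRr : ∀ z, M < z → ∀ f, z • R z f - D (R z f) = f := fun z hz f => by
    exact congrArg (fun T : RealL2 X →L[ℝ] RealL2 X => T f)
      (Ring.mul_inverse_cancel _ (hunit z hz))
  have hRl : ∀ z, M < z → ∀ f, R z (z • f - D f) = f := fun z hz f => by
    exact congrArg (fun T : RealL2 X →L[ℝ] RealL2 X => T f)
      (Ring.inverse_mul_cancel _ (hunit z hz))
  let u : ℝ → RealL2 X := fun z => R z δ
  have hu : ∀ z, M < z → z • u z - D (u z) = δ := fun z hz => hRr z hz δ
  have hδ0 : ∀ x, 0 ≤ δ x := fun x => by rw [hδ]; split_ifs <;> norm_num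
  have hupos : ∀ z, M < z → ∀ x, 0 < u z x := fun z hz =>
    hD.pos_of_resolvent_nonneg hw hU hz he (hu z hz) hδ0 ⟨o, by rw [hδo]; exact one_pos⟩
  have hanti : ∀ z z', M < z → z < z' → u z' o < u z o := fun z z' hz hzz => by
    have hz' := hz.trans hzz
    have hdiff : z • (u z - u z') - D (u z - u z') = (z' - z) • u z' := by
      have h1 := hu z hz
      have h2 := hu z' hz'
      rw [map_sub, smul_sub, sub_smul, sub_sub_sub_comm, h1, ← h2]
      abel
    have hp : ∀ x, 0 < ((z' - z) • u z') x := fun x => by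
      simpa using mul_pos (sub_pos.2 hzz) (hupos z' hz' x)
    have := hD.pos_of_resolvent_nonneg hw hU hz he hdiff (fun x => (hp x).le) ⟨o, hp o⟩ o
    simpa using this
  have hcont : ∀ z, M < z → ContinuousAt (fun z => g * u z o) z := fun z hz => by
    have h1 : ContinuousAt R z := by
      obtain ⟨y, hy⟩ := hunit z hz
      have h2 := NormedRing.inverse_continuousAt y
      rw [hy] at h2
      exact ContinuousAt.comp (f := fun z => algebraMap ℝ (RealL2 X →L[ℝ] RealL2 X) z - D) h2
        (by fun_prop)
    have h3 : ContinuousAt u z := h1.clm_apply continuousAt_const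
    exact continuousAt_const.mul
      ((lp.evalCLM ℝ (fun _ : X => ℝ) 2 o).continuous.continuousAt.comp h3)
  have hMz : M < V o - W := by linarith
  have hlow : 1 ≤ g * u (V o - W) o := by
    have h1 : (V o - W) * u (V o - W) o - D (u (V o - W)) o = 1 := by
      rw [← hδo, ← hu _ hMz, RealL2.sub_apply, RealL2.smul_apply]
    rw [hD] at h1
    simp only [if_true, mul_sub, Finset.sum_sub_distrib, ← Finset.sum_mul, ← hW] at h1
    have h2 : 0 ≤ ∑ j, w j * u (V o - W) (o + e j) :=
      Finset.sum_nonneg fun j _ => mul_nonneg (hw j).le (hupos _ hMz _).le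
    nlinarith
  have hhigh : g * u (V o) o ≤ 1 := by
    have hMV : M < V o := by linarith
    have h1 := hD.le_inner (z := V o) hw hU (u (V o))
    rw [hu _ hMV] at h1
    have h2 : inner ℝ δ (u (V o)) = u (V o) o := by
      simp [δ, lp.inner_single_left]
    rw [h2] at h1
    have h3 : u (V o) o ^ 2 ≤ ‖u (V o)‖ ^ 2 := by
      have h4 := lp.norm_apply_le_norm (by norm_num) (u (V o)) o
      rw [Real.norm_eq_abs] at h4
      exact sq_le_sq' (by linarith [neg_abs_le (u (V o) o)]) ((le_abs_self _).trans h4)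
    have h4 := hupos _ hMV o
    have h5 : g * u (V o) o * u (V o) o ≤ 1 * u (V o) o := by
      have := mul_le_mul_of_nonneg_left h3 hg0.le
      nlinarith
    exact le_of_mul_le_mul_right h5 h4
  obtain ⟨μ, hμI, hμ⟩ := intermediate_value_Icc' (show V o - W ≤ V o by linarith)
    (fun z hz => (hcont z (hMz.trans_le hz.1)).continuousWithinAt) ⟨hhigh, hlow⟩
  have hμ' : g * u μ o = 1 := hμ
  have hMμ : M < μ := hMz.trans_le hμI.1
  have hsolve : ∀ z, M < z → ∀ f, H f = z • f → f = (g * f o) • u z := fun z hz f hf => by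
    have h1 := hRl z hz f
    rw [hDH, hf, sub_sub_cancel, map_smul] at h1
    exact h1.symm
  have heig : H (u μ) = μ • u μ := by
    have h1 := hu μ hMμ
    rw [hDH, hμ', one_smul] at h1
    rw [← sub_eq_zero, ← neg_eq_zero, ← sub_eq_zero.2 h1]
    abel
  refine ⟨μ, hμI.1, ?_, fun z hz hMz => ?_, u μ, hupos μ hMμ, heig, fun f hf =>
    ⟨_, hsolve μ hMμ f hf⟩⟩
  · rw [spectrum.mem_iff, ContinuousLinearMap.isUnit_iff_bijective]
    intro hb
    have h0 : u μ = 0 := hb.1 (by rw [map_zero, RealL2.algebraMap_sub_apply, heig, sub_self])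
    have h1 := hupos μ hMμ o
    rw [h0] at h1
    exact lt_irrefl _ h1
  · have h1 : g * u z o = 1 := by
      by_contra hne
      rw [spectrum.mem_iff, ContinuousLinearMap.isUnit_iff_bijective] at hz
      refine hz ⟨(injective_iff_map_eq_zero _).2 fun f hf => ?_, fun h => ?_⟩
      · have hf' : H f = z • f := by
          rw [RealL2.algebraMap_sub_apply, sub_eq_zero] at hf
          exact hf.symm
        have hs := hsolve z hMz f hf'
        have h2 : f o = g * f o * u z o := by
          conv_lhs => rw [hs, RealL2.smul_apply]
        have h3 : f o = 0 := by
          have : (1 - g * u z o) * f o = 0 := by linarith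
          exact (mul_eq_zero.1 this).resolve_left (sub_ne_zero.2 (Ne.symm hne))
        rw [hs, h3]; simp
      · set t := g * R z h o / (1 - g * u z o) with ht
        have hne' : 1 - g * u z o ≠ 0 := sub_ne_zero.2 (Ne.symm hne)
        have ht' : t = g * (R z h o + t * u z o) := by
          rw [ht]; field_simp; ring
        refine ⟨R z h + t • u z, ?_⟩
        have h2 : z • (R z h + t • u z) - D (R z h + t • u z) = h + t • δ := by
          rw [map_add, map_smul, smul_add, smul_comm z t, add_sub_add_comm, ← smul_sub, hu z hMz,
            hRr z hMz]
        have h3 : (R z h + t • u z) o = R z h o + t * u z o := rfl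
        rw [hDH, h3, ← ht'] at h2
        have h4 : z • (R z h + t • u z) - H (R z h + t • u z) = h := by
          rw [← sub_add] at h2
          exact add_right_cancel h2
        rw [RealL2.algebraMap_sub_apply, h4]
    rcases lt_trichotomy z μ with hlt | heq | hgt
    · exact absurd (mul_lt_mul_of_pos_left (hanti z μ hMz hlt) hg0)
        (by rw [h1, hμ']; exact lt_irrefl 1)
    · exact heq
    · exact absurd (mul_lt_mul_of_pos_left (hanti μ z hMμ hgt) hg0)
        (by rw [h1, hμ']; exact lt_irrefl 1)

/-- The unit steps of a single walker (left) and of all walkers jointly (right). -/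
def walkStep (d p : ℕ) : (Fin p × Fin d × ℤˣ) ⊕ (Fin d × ℤˣ) → Fin p → Fin d → ℤ
  | .inl (i, j, s) => Pi.single i (Pi.single j (s : ℤ))
  | .inr (j, s) => fun _ => Pi.single j (s : ℤ)

lemma closure_range_walkStep (d p : ℕ) :
    AddSubmonoid.closure (Set.range (walkStep d p)) = ⊤ := by
  refine (AddSubmonoid.eq_top_iff' _).2 fun x => ?_
  have hx : x = ∑ i, ∑ j, Pi.single i (Pi.single j (x i j)) := by
    conv_lhs => rw [← Finset.univ_sum_single x]
    refine Finset.sum_congr rfl fun i _ => ?_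
    conv_lhs => rw [← Finset.univ_sum_single (x i)]
    exact map_sum (AddMonoidHom.single (fun _ : Fin p => Fin d → ℤ) i) _ _
  rw [hx]
  refine sum_mem fun i _ => sum_mem fun j _ => ?_
  have hmem : ∀ s : ℤˣ, Pi.single i (Pi.single j (s : ℤ)) ∈
      AddSubmonoid.closure (Set.range (walkStep d p)) := fun s =>
    AddSubmonoid.subset_closure ⟨.inl (i, j, s), rfl⟩
  have hn : ∀ (n : ℕ) (s : ℤˣ), Pi.single i (Pi.single j (n * (s : ℤ))) ∈
      AddSubmonoid.closure (Set.range (walkStep d p)) := fun n s => by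
    have := nsmul_mem (hmem s) n
    rwa [← Pi.single_smul, ← Pi.single_smul, nsmul_eq_mul] at this
  obtain ⟨n, h | h⟩ := Int.eq_nat_or_neg (x i j)
  · rw [h]; simpa using hn n 1
  · rw [h]; simpa using hn n (-1)

/-- Suppose `p ≥ 1` and `γ > 4d(κp + ρ)`. Then
`λ_p := sup σ(H^p)` (with `H^p = A^p + γV^p` the `p`-th Anderson Hamiltonian on
`ℓ²(ℤ^{pd})`) is positive, isolated in the spectrum of `H^p`, and is an
eigenvalue of `H^p` with one-dimensional eigenspace spanned by a strictly
positive function. -/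
theorem principal_eigenfunction_Hp_large_gamma
    (d p : ℕ) (hd : 1 ≤ d) (hp : 1 ≤ p)
    (κ ρ γ : ℝ) (hκ : 0 < κ) (hρ : 0 < ρ)
    (hγ : 4 * d * (κ * p + ρ) < γ)
    (Hp : lp (fun _ : Fin p → Fin d → ℤ => ℝ) 2 →L[ℝ] lp (fun _ : Fin p → Fin d → ℤ => ℝ) 2)
    (hHp : ∀ (f : lp (fun _ : Fin p → Fin d → ℤ => ℝ) 2) (x : Fin p → Fin d → ℤ),
      Hp f x = κ * (∑ i : Fin p, ∑ j : Fin d,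
          ((f (Function.update x i (x i + Pi.single j 1)) - f x)
            + (f (Function.update x i (x i - Pi.single j 1)) - f x)))
        + ρ * (∑ j : Fin d,
          ((f (fun i => x i + Pi.single j 1) - f x)
            + (f (fun i => x i - Pi.single j 1) - f x)))
        + γ * ((∑ i : Fin p, if x i = 0 then (1:ℝ) else 0) * f x)) :
    0 < sSup (spectrum ℝ Hp) ∧
    (∃ ε : ℝ, 0 < ε ∧
      spectrum ℝ Hp ∩ Set.Ioo (sSup (spectrum ℝ Hp) - ε) (sSup (spectrum ℝ Hp) + ε)
        = {sSup (spectrum ℝ Hp)}) ∧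
    ∃ v : lp (fun _ : Fin p → Fin d → ℤ => ℝ) 2,
      (∀ x : Fin p → Fin d → ℤ, 0 < v x) ∧
      Hp v = sSup (spectrum ℝ Hp) • v ∧
      ∀ w : lp (fun _ : Fin p → Fin d → ℤ => ℝ) 2,
        Hp w = sSup (spectrum ℝ Hp) • w → ∃ c : ℝ, w = c • v := by
  have hdR : (1 : ℝ) ≤ d := by exact_mod_cast hd
  have hpR : (1 : ℝ) ≤ p := by exact_mod_cast hp
  let w : (Fin p × Fin d × ℤˣ) ⊕ (Fin d × ℤˣ) → ℝ := Sum.elim (fun _ => κ) (fun _ => ρ)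
  have hw : ∀ j, 0 < w j := by rintro (_ | _) <;> simpa [w]
  have hWsum : ∑ j, w j = 2 * d * (κ * p + ρ) := by
    simp [w, Fintype.card_units_int]; ring
  have hγ0 : 2 * d * (κ * p + ρ) < γ := by
    have : 0 < d * (κ * p + ρ) := by positivity
    linarith
  have hW0 : 0 < 2 * d * (κ * p + ρ) := by positivity
  have hS : IsSchrodinger (walkStep d p) w
      (fun x => γ * ∑ i : Fin p, if x i = 0 then (1 : ℝ) else 0) Hp := fun f x => by
    have hupd : ∀ (i : Fin p) (v : Fin d → ℤ),
        Function.update x i (x i + v) = x + Pi.single i v := fun i v => by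
      ext k l
      by_cases hk : k = i
      · subst hk; simp
      · simp [hk]
    have hconst : ∀ v : Fin d → ℤ, (fun i => x i + v) = x + fun _ => v := fun v => rfl
    rw [hHp]
    simp only [sub_eq_add_neg (x _) (Pi.single _ _), ← Pi.single_neg, hupd, hconst]
    simp [w, walkStep, Fintype.sum_sum_type, Fintype.sum_prod_type, Finset.mul_sum,
      UnitsInt.univ, mul_add, mul_assoc]
  have hV : ∀ x : Fin p → Fin d → ℤ, x ≠ 0 →
      γ * ∑ i : Fin p, (if x i = 0 then (1 : ℝ) else 0) ≤ γ * (p - 1) := fun x hx => by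
    obtain ⟨i, hi⟩ := Function.ne_iff.1 hx
    refine mul_le_mul_of_nonneg_left ?_ (hW0.trans hγ0).le
    rw [← Finset.sum_erase_add _ _ (Finset.mem_univ i), if_neg (show ¬x i = 0 from hi), add_zero]
    refine (Finset.sum_le_card_nsmul _ _ 1 fun k _ => by split_ifs <;> norm_num).trans ?_
    simp [Finset.card_erase_of_mem, Nat.cast_sub hp]
  have hVo : γ * ∑ i : Fin p, (if (0 : Fin p → Fin d → ℤ) i = 0 then (1 : ℝ) else 0) = γ * p := by
    simp
  obtain ⟨μ, hμ, hmem, huniq, v, hv⟩ := hS.exists_principal_eigenfunction hw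
    (closure_range_walkStep d p) hV (by rw [hVo, hWsum]; linarith)
  rw [hVo, hWsum] at hμ
  have hM0 : 0 ≤ γ * ((p : ℝ) - 1) := mul_nonneg (hW0.trans hγ0).le (by linarith)
  have hMμ : γ * ((p : ℝ) - 1) < μ := by linarith
  have hsup : sSup (spectrum ℝ Hp) = μ := by
    refine IsGreatest.csSup_eq ⟨hmem, fun z hz => ?_⟩
    rcases le_or_gt z (γ * ((p : ℝ) - 1)) with h | h
    · exact h.trans hMμ.le
    · exact (huniq z hz h).le
  rw [hsup]
  refine ⟨hM0.trans_lt hMμ, ⟨μ - γ * ((p : ℝ) - 1), sub_pos.2 hMμ, ?_⟩, v, hv⟩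
  ext z
  simp only [Set.mem_inter_iff, Set.mem_Ioo, Set.mem_singleton_iff]
  constructor
  · rintro ⟨hz, h, -⟩
    exact huniq z hz (by linarith)
  · rintro rfl
    exact ⟨hmem, by linarith, by linarith⟩
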